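/- Let α ∈ (0,1] and let ρ_α^{MP} be the Marchenko–Pastur law with density √((α₊ − t)(t − α₋))/(2παt) on [α₋, α₊], where α_± = (1 ± √α)². Then the limiting value of its Hilbert transform at the top edge is lim_{z↓α₊} ∫_{α₋}^{α₊} ρ_α^{MP}(t)/(z−t) dt = 1/(√α(1+√α)). Moreover, 1/(√α(1+√α)) ≥ 1 if and only if α ≤ (√5 − 1)²/4. -/

import Mathlib

open Filter

lemma mp_deriv1 (p q t : ℝ) (h : p^2 < q^2) (h1 : p^2 < t) (h2 : t < q^2) :
    HasDerivAt (fun t => Real.arcsin ((2*t - p^2 - q^2)/(q^2-p^2)))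
      (1 / Real.sqrt ((q^2-t)*(t-p^2))) t := by
  have hd : 0 < q^2 - p^2 := by linarith
  have hR : 0 < (q^2-t)*(t-p^2) := mul_pos (by linarith) (by linarith)
  have hS := Real.sqrt_pos.2 hR
  have e : 1 - ((2*t - p^2 - q^2)/(q^2-p^2))^2 = (2 * Real.sqrt ((q^2-t)*(t-p^2)) / (q^2-p^2))^2 := by
    rw [div_pow, div_pow, mul_pow, Real.sq_sqrt hR.le]
    field_simp
    ring
  have hpos : 0 < 2 * Real.sqrt ((q^2-t)*(t-p^2)) / (q^2-p^2) := by positivity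
  have hlt : 0 < 1 - ((2*t - p^2 - q^2)/(q^2-p^2))^2 := by rw [e]; positivity
  have hi : HasDerivAt (fun t : ℝ => (2*t - p^2 - q^2)/(q^2-p^2)) (2/(q^2-p^2)) t := by
    have := ((((hasDerivAt_id t).const_mul 2).sub_const (p^2)).sub_const (q^2)).div_const (q^2-p^2)
    simpa using this
  have := (Real.hasDerivAt_arcsin (x := (2*t - p^2 - q^2)/(q^2-p^2))
    (by intro h; rw [h] at hlt; norm_num at hlt) (by intro h; rw [h] at hlt; norm_num at hlt)).comp t hi
  refine this.congr_deriv ?_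
  rw [e, Real.sqrt_sq hpos.le]
  field_simp

lemma mp_deriv2 (p q t : ℝ) (hp : 0 < p) (hq : p < q) (h1 : p^2 < t) (h2 : t < q^2) :
    HasDerivAt (fun t => Real.arcsin (((p^2+q^2)*t - 2*p^2*q^2)/(t*(q^2-p^2))))
      (p*q / (t*Real.sqrt ((q^2-t)*(t-p^2)))) t := by
  have hq0 : 0 < q := by linarith
  have ht : 0 < t := by nlinarith
  have hd : 0 < q^2 - p^2 := by nlinarith
  have hR : 0 < (q^2-t)*(t-p^2) := mul_pos (by linarith) (by linarith)
  have hS := Real.sqrt_pos.2 hR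
  have e : 1 - (((p^2+q^2)*t - 2*p^2*q^2)/(t*(q^2-p^2)))^2
      = (2 *p*q* Real.sqrt ((q^2-t)*(t-p^2)) / (t*(q^2-p^2)))^2 := by
    rw [div_pow, div_pow, mul_pow _ (Real.sqrt _), Real.sq_sqrt hR.le]
    field_simp
    ring
  have hpos : 0 < 2 *p*q* Real.sqrt ((q^2-t)*(t-p^2)) / (t*(q^2-p^2)) := by positivity
  have hlt : 0 < 1 - (((p^2+q^2)*t - 2*p^2*q^2)/(t*(q^2-p^2)))^2 := by rw [e]; positivity
  have hi : HasDerivAt (fun t : ℝ => ((p^2+q^2)*t - 2*p^2*q^2)/(t*(q^2-p^2)))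
      (2*p^2*q^2/(t^2*(q^2-p^2))) t := by
    have := (((hasDerivAt_id t).const_mul (p^2+q^2)).sub_const (2*p^2*q^2)).div
      ((hasDerivAt_id t).mul_const (q^2-p^2)) (by simp only [id]; positivity)
    refine this.congr_deriv ?_
    simp only [id]
    field_simp
    ring
  have := (Real.hasDerivAt_arcsin (x := ((p^2+q^2)*t - 2*p^2*q^2)/(t*(q^2-p^2)))
    (by intro h; rw [h] at hlt; norm_num at hlt) (by intro h; rw [h] at hlt; norm_num at hlt)).comp t hi
  refine this.congr_deriv ?_
  rw [e, Real.sqrt_sq hpos.le]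
  field_simp

lemma mp_int (p q : ℝ) (hp : 0 ≤ p) (hq : p < q) (c : ℝ) (hc : 0 < c) :
    IntervalIntegrable (fun t => Real.sqrt ((q^2-t)*(t-p^2)) / (c*t) / (q^2-t))
      MeasureTheory.volume (p^2) (q^2) ∧
    ∫ t in (p^2)..(q^2), Real.sqrt ((q^2-t)*(t-p^2)) / (c*t) / (q^2-t)
      = Real.pi * (1 - p/q) / c := by
  have hq0 : 0 < q := by linarith
  have hd : 0 < q^2 - p^2 := by nlinarith
  have hle : p^2 ≤ q^2 := by linarith
  let F : ℝ → ℝ := fun t => (Real.arcsin ((2*t - p^2 - q^2)/(q^2-p^2))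
    - p/q * Real.arcsin (((p^2+q^2)*t - 2*p^2*q^2)/(t*(q^2-p^2)))) / c
  have hF : ContinuousOn F (Set.Icc (p^2) (q^2)) := by
    rcases hp.eq_or_lt with h0 | h0
    · subst h0
      simp only [F, zero_div, zero_mul, sub_zero]
      fun_prop
    · apply ContinuousOn.div_const
      apply ContinuousOn.sub
      · fun_prop
      · apply ContinuousOn.mul continuousOn_const
        apply Real.continuous_arcsin.comp_continuousOn
        apply ContinuousOn.div (by fun_prop) (by fun_prop)
        intro t ht
        have : 0 < t := lt_of_lt_of_le (by positivity) ht.1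
        positivity
  have hF' : ∀ t ∈ Set.Ioo (p^2) (q^2),
      HasDerivAt F (Real.sqrt ((q^2-t)*(t-p^2)) / (c*t) / (q^2-t)) t := by
    intro t ht
    have ht0 : 0 < t := lt_of_le_of_lt (by positivity) ht.1
    have h3 : 0 < q^2 - t := by linarith [ht.2]
    have h4 : 0 < t - p^2 := by linarith [ht.1]
    have hR : 0 < (q^2-t)*(t-p^2) := mul_pos h3 h4
    have hS := Real.sqrt_pos.2 hR
    have hsq := Real.sq_sqrt hR.le
    have key : Real.sqrt ((q^2-t)*(t-p^2)) / (c*t) / (q^2-t)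
        = (1 / Real.sqrt ((q^2-t)*(t-p^2)) - p/q * (p*q / (t*Real.sqrt ((q^2-t)*(t-p^2))))) / c := by
      generalize Real.sqrt ((q^2-t)*(t-p^2)) = S at *
      field_simp
      linear_combination hsq
    rw [key]
    rcases hp.eq_or_lt with h0 | h0
    · subst h0
      have := (mp_deriv1 0 q t (by linarith) ht.1 ht.2).div_const c
      simpa [F] using this
    · exact ((mp_deriv1 p q t (by linarith) ht.1 ht.2).sub
        ((mp_deriv2 p q t h0 hq ht.1 ht.2).const_mul (p/q))).div_const c
  have hI : IntervalIntegrable (fun t => Real.sqrt ((q^2-t)*(t-p^2)) / (c*t) / (q^2-t))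
      MeasureTheory.volume (p^2) (q^2) := by
    rw [intervalIntegrable_iff_integrableOn_Ioc_of_le hle]
    apply intervalIntegral.integrableOn_deriv_of_nonneg hF hF'
    intro t ht
    have ht0 : 0 < t := lt_of_le_of_lt (by positivity) ht.1
    have h3 : 0 < q^2 - t := by linarith [ht.2]
    positivity
  refine ⟨hI, ?_⟩
  rw [intervalIntegral.integral_eq_sub_of_hasDerivAt_of_le hle hF hF' hI]
  have e1 : (2*q^2 - p^2 - q^2)/(q^2-p^2) = 1 := by rw [div_eq_one_iff_eq hd.ne']; ring
  have e2 : (2*p^2 - p^2 - q^2)/(q^2-p^2) = -1 := by rw [div_eq_iff hd.ne']; ring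
  have e3 : ((p^2+q^2)*q^2 - 2*p^2*q^2)/(q^2*(q^2-p^2)) = 1 := by
    rw [div_eq_one_iff_eq (by positivity)]; ring
  simp only [F, e1, e2, e3]
  rcases hp.eq_or_lt with h0 | h0
  · subst h0
    simp
    ring
  · have e4 : ((p^2+q^2)*p^2 - 2*p^2*q^2)/(p^2*(q^2-p^2)) = -1 := by
      rw [div_eq_iff (by positivity)]; ring
    rw [e4, Real.arcsin_one, Real.arcsin_neg_one]
    ring



/-- the Hilbert transform of the Marchenko–Pastur law of parameter `α ∈ (0,1]`
(density `√((α₊-t)(t-α₋))/(2παt)` on `[α₋,α₊]`, `α± = (1±√α)²`) tends to `1/(√α(1+√α))` as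
`z ↓ α₊`; moreover `1/(√α(1+√α)) ≥ 1 ↔ α ≤ (√5-1)²/4`. -/
theorem stmt_14 (α : ℝ) (hα : α ∈ Set.Ioc (0 : ℝ) 1) :
    Tendsto
      (fun z : ℝ => ∫ t in ((1 - Real.sqrt α) ^ 2)..((1 + Real.sqrt α) ^ 2),
        (Real.sqrt (((1 + Real.sqrt α) ^ 2 - t) * (t - (1 - Real.sqrt α) ^ 2))
          / (2 * Real.pi * α * t)) / (z - t))
      (nhdsWithin ((1 + Real.sqrt α) ^ 2) (Set.Ioi ((1 + Real.sqrt α) ^ 2)))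
      (nhds (1 / (Real.sqrt α * (1 + Real.sqrt α)))) ∧
    (1 ≤ 1 / (Real.sqrt α * (1 + Real.sqrt α)) ↔ α ≤ (Real.sqrt 5 - 1) ^ 2 / 4) := by


  have hα0 := hα.1
  have hs0 : 0 < Real.sqrt α := Real.sqrt_pos.2 hα0
  have hs1 : Real.sqrt α ≤ 1 := Real.sqrt_le_one.2 hα.2
  have hsq : Real.sqrt α ^ 2 = α := Real.sq_sqrt hα0.le
  have hpi := Real.pi_pos
  constructor
  · obtain ⟨hI, hv⟩ := mp_int (1 - Real.sqrt α) (1 + Real.sqrt α) (by linarith) (by linarith)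
      (2 * Real.pi * α) (by positivity)
    have hval : Real.pi * (1 - (1 - Real.sqrt α)/(1 + Real.sqrt α)) / (2 * Real.pi * α)
        = 1 / (Real.sqrt α * (1 + Real.sqrt α)) := by
      have : 0 < 1 + Real.sqrt α := by linarith
      field_simp
      linear_combination 2 * hsq
    rw [← hval, ← hv]
    have hle : (1 - Real.sqrt α)^2 ≤ (1 + Real.sqrt α)^2 := by nlinarith
    apply intervalIntegral.tendsto_integral_filter_of_dominated_convergence _ _ _ hI
    · refine Filter.Eventually.of_forall fun t ht => ?_
      rw [Set.uIoc_of_le hle] at ht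
      rcases ht.2.eq_or_lt with h | h
      · subst h; simp
      · apply Tendsto.mono_left _ nhdsWithin_le_nhds
        have : ContinuousAt (fun z : ℝ => Real.sqrt (((1 + Real.sqrt α) ^ 2 - t) * (t - (1 - Real.sqrt α) ^ 2))
          / (2 * Real.pi * α * t) / (z - t)) ((1 + Real.sqrt α) ^ 2) := by
          apply ContinuousAt.div (by fun_prop) (by fun_prop)
          exact (sub_pos.2 h).ne'
        exact this
    · refine Eventually.of_forall fun z => Measurable.aestronglyMeasurable (by fun_prop)
    · filter_upwards [self_mem_nhdsWithin] with z hz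
      refine Filter.Eventually.of_forall fun t ht => ?_
      rw [Set.uIoc_of_le hle] at ht
      have hz : (1 + Real.sqrt α) ^ 2 < z := hz
      have ht0 : 0 < t := lt_of_le_of_lt (by positivity) ht.1
      rcases ht.2.eq_or_lt with h | h
      · subst h; simp
      · have h3 := sub_pos.2 h
        have h5 : 0 < z - t := by linarith
        rw [Real.norm_of_nonneg (by positivity)]
        gcongr
  · have h5 : Real.sqrt 5 ^ 2 = 5 := Real.sq_sqrt (by norm_num)
    have h51 : 1 < Real.sqrt 5 := by rw [Real.lt_sqrt] <;> norm_num
    rw [one_le_div (by positivity)]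
    generalize Real.sqrt α = s at *
    generalize Real.sqrt 5 = r at *
    subst hsq
    have : (r-1)^2/4 = ((r-1)/2)^2 := by ring
    rw [this, sq_le_sq₀ hs0.le (by linarith)]
    constructor
    · intro h
      by_contra hh
      push Not at hh
      nlinarith
    · intro h
      nlinarith
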